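/- Let K be a subcomplex of I^n, let k ≥ 1, and let S ⊆ K be a subcomplex that is isomorphic to ∂I^{k+1}. Then S is a face-like subcomplex of K if and only if S is not the boundary of a (k+1)-dimensional face of K; that is, if and only if there is no (k+1)-dimensional face F ∈ K with S = ∂F̂. -/

import Mathlib

/-- A face of the cube `I^n`: `none` marks a free coordinate. -/
def CubeFace (n : ℕ) : Type := Fin n → Option Bool

namespace CubeFace

/-- The order on faces of the cube: `F ≤ G` iff every coordinate of `G` is free
or agrees with the corresponding coordinate of `F`. -/
instance (n : ℕ) : PartialOrder (CubeFace n) where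
  le F G := ∀ i, G i = none ∨ F i = G i
  le_refl F i := Or.inr rfl
  le_trans F G H h1 h2 i := by
    rcases h2 i with h | h
    · exact Or.inl h
    · rcases h1 i with h' | h'
      · exact Or.inl (h ▸ h')
      · exact Or.inr (h' ▸ h)
  le_antisymm F G h1 h2 := by
    funext i
    rcases h1 i with h | h
    · rcases h2 i with h' | h'
      · rw [h, h']
      · rw [← h', h]
    · exact h

/-- The face of `I^n` corresponding to a vertex. -/
def toFace {n : ℕ} (v : Fin n → Bool) : CubeFace n := fun i => some (v i)

/-- The vertex set of a face. -/
def verts {n : ℕ} (F : CubeFace n) : Set (Fin n → Bool) := {v | toFace v ≤ F}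

/-- The dimension of a face: its number of free coordinates. -/
def dim {n : ℕ} (F : CubeFace n) : ℕ :=
  haveI : DecidablePred (fun i => F i = none) := fun i => decEq (F i) none
  (Finset.univ.filter (fun i => F i = none)).card

/-- A subcomplex of `I^n`: a nonempty, downward closed set of faces. -/
def IsSubcomplex {n : ℕ} (K : Set (CubeFace n)) : Prop :=
  K.Nonempty ∧ ∀ F ∈ K, ∀ G : CubeFace n, G ≤ F → G ∈ K

/-- The vertex set of a subcomplex. -/
def cvert {n : ℕ} (K : Set (CubeFace n)) : Set (Fin n → Bool) := {v | toFace v ∈ K}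

/-- A subcomplex `Γ ⊆ K` is face-like if, for every face `F` of `K`, the set of vertices
of `F` belonging to `Γ` is empty or the vertex set of a face of `Γ`. -/
def FaceLike {n : ℕ} (K Γ : Set (CubeFace n)) : Prop :=
  ∀ F ∈ K, verts F ∩ cvert Γ = ∅ ∨ ∃ G ∈ Γ, verts F ∩ cvert Γ = verts G

/-- The deletion `K ∖ Γ`: the faces of `K` with no vertex in `Γ`. -/
def delete {n : ℕ} (K Γ : Set (CubeFace n)) : Set (CubeFace n) :=
  {F | F ∈ K ∧ verts F ∩ cvert Γ = ∅}

/-- The geometric realization of a subcomplex of `I^n`, as a subset of `ℝ^n`. -/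
def real {n : ℕ} (K : Set (CubeFace n)) : Set (Fin n → ℝ) :=
  ⋃ F ∈ K, {x | (∀ i, 0 ≤ x i ∧ x i ≤ 1) ∧
    ∀ i, (F i = some false → x i = 0) ∧ (F i = some true → x i = 1)}

/-- The boundary `∂F̂` of a face `F`: all faces strictly below `F`. -/
def bdryHat {n : ℕ} (F : CubeFace n) : Set (CubeFace n) := {G | G ≤ F ∧ G ≠ F}

/-- The boundary of the cube `I^k`: all faces except the top one. -/
def boundaryCube (k : ℕ) : Set (CubeFace k) := {F | F ≠ fun _ => none}

/-- The `k`-skeleton of a subcomplex. -/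
def skel {n : ℕ} (k : ℕ) (K : Set (CubeFace n)) : Set (CubeFace n) :=
  {F | F ∈ K ∧ dim F ≤ k}

/-- Isomorphism of cubical subcomplexes: a bijection between the vertex sets under which
vertex sets of faces correspond to vertex sets of faces. -/
def Iso {m n : ℕ} (K : Set (CubeFace m)) (L : Set (CubeFace n)) : Prop :=
  ∃ f : (Fin m → Bool) → (Fin n → Bool),
    Set.BijOn f (cvert K) (cvert L) ∧
    ∀ W : Set (Fin m → Bool), W ⊆ cvert K →
      ((∃ F ∈ K, verts F = W) ↔ (∃ G ∈ L, verts G = f '' W))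

/-- `K` has dimension `d`. -/
def HasDim {n : ℕ} (K : Set (CubeFace n)) (d : ℕ) : Prop :=
  (∀ F ∈ K, dim F ≤ d) ∧ ∃ F ∈ K, dim F = d

end CubeFace


namespace CubeFace

theorem mem_verts {n : ℕ} (F : CubeFace n) (v : Fin n → Bool) :
    v ∈ verts F ↔ ∀ i, F i = none ∨ some (v i) = F i := Iff.rfl

theorem le_def' {n : ℕ} (F G : CubeFace n) :
    F ≤ G ↔ ∀ i, G i = none ∨ F i = G i := Iff.rfl

/-- flip a coordinate -/
def flp {n : ℕ} (i : Fin n) (v : Fin n → Bool) : Fin n → Bool :=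
  fun j => if j = i then !(v j) else v j

theorem flp_flp {n : ℕ} (i : Fin n) (v : Fin n → Bool) : flp i (flp i v) = v := by
  funext j; unfold flp; split_ifs <;> simp

theorem flp_comm {n : ℕ} (i j : Fin n) (v : Fin n → Bool) :
    flp i (flp j v) = flp j (flp i v) := by
  funext l; unfold flp; split_ifs <;> simp

theorem flp_ne {n : ℕ} (i : Fin n) (v : Fin n → Bool) : flp i v ≠ v := by
  intro h
  have := congrFun h i
  simp [flp] at this

theorem flp_inj {n : ℕ} {i j : Fin n} {v : Fin n → Bool} (h : flp i v = flp j v) : i = j := by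
  by_contra hij
  have := congrFun h i
  simp [flp, hij] at this

theorem flp_square {n : ℕ} {a b a' b' : Fin n} {x : Fin n → Bool}
    (h : flp a' (flp b x) = flp b' (flp a x)) (hab : a ≠ b) (hb : b' ≠ a) : a' = a := by
  by_contra hne
  have := congrFun h a
  simp [flp, hab, Ne.symm hb, Ne.symm hne] at this

theorem flp_induction {n : ℕ} (P : (Fin n → Bool) → Prop) (z : Fin n → Bool) (h0 : P z)
    (hs : ∀ v i, P v → P (flp i v)) (w : Fin n → Bool) : P w := by
  have key : ∀ s : Finset (Fin n), ∀ w : Fin n → Bool, (∀ i, i ∉ s → w i = z i) → P w := by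
    intro s
    induction s using Finset.induction_on with
    | empty =>
      intro w hw
      have : w = z := funext fun i => hw i (by simp)
      exact this ▸ h0
    | insert a s ha ih =>
      intro w hw
      by_cases hwa : w a = z a
      · apply ih
        intro i hi
        by_cases hia : i = a
        · exact hia ▸ hwa
        · exact hw i (by simp [hi, hia])
      · rw [← flp_flp a w]
        apply hs
        apply ih
        intro i hi
        by_cases hia : i = a
        · subst hia
          simp only [flp, if_true]
          revert hwa
          cases w i <;> cases z i <;> simp
        · simp only [flp, hia, if_false]
          exact hw i (by simp [hi, hia])
  exact key Finset.univ w (by simp)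

theorem verts_nonempty {n : ℕ} (F : CubeFace n) : (verts F).Nonempty := by
  refine ⟨fun i => (F i).getD false, ?_⟩
  intro i
  cases h : F i <;> simp [toFace, h]

theorem flp_mem_verts {n : ℕ} {F : CubeFace n} {v : Fin n → Bool} {i : Fin n}
    (hv : v ∈ verts F) (hi : F i = none) : flp i v ∈ verts F := by
  rw [mem_verts] at *
  intro j
  by_cases hj : j = i
  · exact Or.inl (hj ▸ hi)
  · simpa [flp, hj] using hv j

theorem le_of_verts {n : ℕ} {F G : CubeFace n} (h : verts F ⊆ verts G) : F ≤ G := by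
  obtain ⟨v, hv⟩ := verts_nonempty F
  intro i
  by_cases hG : G i = none
  · exact Or.inl hG
  right
  have h1 := (h hv) i
  by_cases hF : F i = none
  · exfalso
    have h2 := h (flp_mem_verts hv hF) i
    simp only [hG, false_or, toFace] at h1 h2
    rw [← h1] at h2
    simp [flp] at h2
  · have h3 := hv i
    simp only [hG, hF, false_or] at h1 h3
    rw [← h3, h1]

theorem verts_mono {n : ℕ} {F G : CubeFace n} (h : F ≤ G) : verts F ⊆ verts G :=
  fun _ hv => le_trans hv h

theorem verts_inj {n : ℕ} {F G : CubeFace n} (h : verts F = verts G) : F = G :=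
  le_antisymm (le_of_verts h.le) (le_of_verts h.ge)

theorem toFace_mem {n : ℕ} {K : Set (CubeFace n)} (hK : IsSubcomplex K) {F : CubeFace n}
    (hF : F ∈ K) : verts F ⊆ cvert K := fun v hv => hK.2 F hF (toFace v) hv

theorem sphere_eq_bdry {n k : ℕ} (hk : 1 ≤ k)
    (S : Set (CubeFace n)) (hS : IsSubcomplex S)
    (hiso : Iso S (boundaryCube (k + 1))) :
    ∃ T : CubeFace n, dim T = k + 1 ∧ S = bdryHat T ∧ cvert S = verts T := by
  obtain ⟨f, hf, hW⟩ := hiso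
  have hall : ∀ v : Fin (k+1) → Bool, v ∈ cvert (boundaryCube (k+1)) := by
    intro v h
    have := congrFun h 0
    simp [toFace] at this
  have hex : ∀ v, ∃ w, w ∈ cvert S ∧ f w = v := fun v => hf.surjOn (hall v)
  choose g hgS hfg using hex
  have hgf : ∀ w ∈ cvert S, g (f w) = w := fun w hw =>
    hf.injOn (hgS _) hw (hfg _)
  have ginj : Function.Injective g := fun a b h => by rw [← hfg a, ← hfg b, h]
  have htrans : ∀ G' : CubeFace (k+1), G' ∈ boundaryCube (k+1) →
      ∃ F ∈ S, verts F = g '' verts G' := by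
    intro G' hG'
    apply (hW (g '' verts G') (by rintro _ ⟨v, _, rfl⟩; exact hgS v)).2
    refine ⟨G', hG', ?_⟩
    rw [Set.image_image]
    simp [hfg]
  -- edges
  have hedge : ∀ v i, ∃ j, g (flp i v) = flp j (g v) := by
    intro v i
    let E : CubeFace (k+1) := fun j => if j = i then none else some (v j)
    have hE : E ∈ boundaryCube (k+1) := by
      intro h
      haveI : Nontrivial (Fin (k+1)) := Fin.nontrivial_iff_two_le.2 (by omega)
      obtain ⟨j, hj⟩ := exists_ne i
      have := congrFun h j
      simp [E, hj] at this
    have hv1 : v ∈ verts E := by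
      rw [mem_verts]; intro j
      by_cases hj : j = i <;> simp [E, hj]
    have hEv : ∀ w ∈ verts E, w = v ∨ w = flp i v := by
      intro w hw
      rw [mem_verts] at hw
      have h1 : ∀ j, j ≠ i → w j = v j := by
        intro j hj
        have := hw j
        simpa [E, hj] using this
      by_cases hi : w i = v i
      · left; funext j
        by_cases hj : j = i
        · rw [hj, hi]
        · exact h1 j hj
      · right; funext j
        by_cases hj : j = i
        · subst hj
          simp only [flp, if_true]
          revert hi
          cases w j <;> cases v j <;> simp
        · simp [flp, hj, h1 j hj]
    have hv2 : flp i v ∈ verts E := flp_mem_verts hv1 (by simp [E])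
    obtain ⟨F, hFS, hF⟩ := htrans E hE
    have m1 : g v ∈ verts F := hF ▸ ⟨v, hv1, rfl⟩
    have m2 : g (flp i v) ∈ verts F := hF ▸ ⟨_, hv2, rfl⟩
    have hne : g (flp i v) ≠ g v := fun h => flp_ne i v (ginj h)
    obtain ⟨j, hj⟩ := Function.ne_iff.1 hne
    have hFj : F j = none := by
      by_contra hc
      have a1 := m1 j
      have a2 := m2 j
      simp only [hc, false_or, toFace] at a1 a2
      rw [← a1] at a2
      exact hj (Option.some.inj a2)
    refine ⟨j, ?_⟩
    have m3 := flp_mem_verts m1 hFj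
    rw [hF] at m3
    obtain ⟨w, hw, hwe⟩ := m3
    rcases hEv w hw with h | h
    · subst h; exact absurd hwe.symm (flp_ne _ _)
    · rw [← h, hwe]
  choose c hc using hedge
  have hcstep : ∀ v i j, c (flp j v) i = c v i := by
    intro v i j
    by_cases hij : i = j
    · subst hij
      have h1 := hc (flp i v) i
      rw [flp_flp, hc v i] at h1
      have h2 := congrArg (flp (c v i)) h1
      rw [flp_comm, flp_flp] at h2
      have h3 : flp (c v i) (g v) = flp (c (flp i v) i) (g v) := by
        conv_lhs => rw [h1]
        rw [flp_comm, flp_flp]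
      exact (flp_inj h3).symm
    · have h := flp_comm i j v
      have h1 := congrArg g h
      rw [hc, hc, hc, hc] at h1
      refine flp_square h1 ?_ ?_
      · intro hab
        have : g (flp i v) = g (flp j v) := by rw [hc, hc, hab]
        exact hij (flp_inj (ginj this))
      · intro hab
        have h2 : g (flp j (flp i v)) = g v := by rw [hc, hc, hab, flp_flp]
        have h3 := congrFun (ginj h2) j
        simp [flp, Ne.symm hij] at h3
  let o : Fin (k+1) → Bool := fun _ => false
  have hconst : ∀ v i, c v i = c o i := by
    intro v
    refine flp_induction (fun v => ∀ i, c v i = c o i) o (fun _ => rfl) ?_ v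
    intro v j h i
    rw [hcstep, h]
  let C := c o
  let z := g o
  have hgC : ∀ v i, g (flp i v) = flp (C i) (g v) := by
    intro v i; rw [hc, hconst]
  have Cinj : Function.Injective C := by
    intro i j h
    have : g (flp i o) = g (flp j o) := by rw [hgC, hgC, h]
    exact flp_inj (ginj this)
  have hg1 : ∀ v i, g v (C i) = xor (z (C i)) (v i) := by
    intro v
    refine flp_induction (fun v => ∀ i, g v (C i) = xor (z (C i)) (v i)) o ?_ ?_ v
    · intro i; simp [z, o]
    · intro v j h i
      rw [hgC]
      by_cases hij : i = j
      · subst hij; simp [flp, h]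
      · have : C i ≠ C j := fun hh => hij (Cinj hh)
        simp [flp, h, hij, this]
  have hg2 : ∀ v j, j ∉ Set.range C → g v j = z j := by
    intro v
    refine flp_induction (fun v => ∀ j, j ∉ Set.range C → g v j = z j) o ?_ ?_ v
    · intro i _; rfl
    · intro v i h j hj
      have : j ≠ C i := fun hh => hj ⟨i, hh.symm⟩
      rw [hgC]
      simp [flp, this, h j hj]
  classical
  let T : CubeFace n := fun j => if j ∈ Set.range C then none else some (z j)
  have hTC : ∀ i, T (C i) = none := fun i => if_pos ⟨i, rfl⟩
  have hTn : ∀ j, j ∉ Set.range C → T j = some (z j) := fun j hj => if_neg hj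
  have hgT : ∀ v, g v ∈ verts T := by
    intro v
    rw [mem_verts]; intro j
    by_cases hj : j ∈ Set.range C
    · left; obtain ⟨i, rfl⟩ := hj; exact hTC i
    · right; rw [hTn j hj, hg2 v j hj]
  -- inverse of g on T
  have hTg : ∀ w ∈ verts T, g (fun i => xor (z (C i)) (w (C i))) = w := by
    intro w hw
    funext j
    by_cases hj : j ∈ Set.range C
    · obtain ⟨i, rfl⟩ := hj
      rw [hg1]
      cases z (C i) <;> cases w (C i) <;> rfl
    · rw [hg2 _ j hj]
      have := hw j
      rw [hTn j hj] at this
      simpa [toFace, eq_comm] using this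
  have hcv : cvert S = verts T := by
    ext w; constructor
    · intro hw; rw [← hgf w hw]; exact hgT _
    · intro hw; rw [← hTg w hw]; exact hgS _
  refine ⟨T, ?_, ?_, hcv⟩
  · unfold dim
    have : (Finset.univ.filter (fun j => T j = none)) = Finset.univ.image C := by
      ext j
      by_cases hj : j ∈ Set.range C
      · have h2 := hj
        obtain ⟨i, rfl⟩ := hj
        simp [hTC]
      · have h2 := hj
        simp only [Set.mem_range, not_exists] at h2
        simp [hTn j hj, h2]
    have h2 : (Finset.univ.filter (fun j => T j = none)).card = k + 1 := by
      rw [this, Finset.card_image_of_injective _ Cinj]; simp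
    convert h2
  · ext G
    constructor
    · intro hG
      have hGs : verts G ⊆ cvert S := toFace_mem hS hG
      refine ⟨le_of_verts (hcv ▸ hGs), ?_⟩
      rintro rfl
      obtain ⟨G', hG', he⟩ := (hW _ hGs).1 ⟨_, hG, rfl⟩
      apply hG'
      apply verts_inj
      rw [he]
      ext v
      constructor
      · intro _ i; exact Or.inl rfl
      · intro _; exact ⟨g v, hgT v, hfg v⟩
    · rintro ⟨hle, hne⟩
      let G' : CubeFace (k+1) := fun i => (G (C i)).map (fun b => xor (z (C i)) b)
      have hGn : ∀ j, j ∉ Set.range C → G j = some (z j) := by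
        intro j hj
        have := hle j
        rw [hTn j hj] at this
        simpa using this
      have hG' : G' ∈ boundaryCube (k+1) := by
        intro h
        apply hne
        funext j
        by_cases hj : j ∈ Set.range C
        · obtain ⟨i, rfl⟩ := hj
          rw [hTC]
          have := congrFun h i
          simpa [G'] using this
        · rw [hTn j hj, hGn j hj]
      obtain ⟨F, hFS, hF⟩ := htrans G' hG'
      have : F = G := by
        apply verts_inj
        rw [hF]
        have hiff : ∀ v, v ∈ verts G' ↔ g v ∈ verts G := by
          intro v
          rw [mem_verts, mem_verts]
          constructor
          · intro h j
            by_cases hj : j ∈ Set.range C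
            · obtain ⟨i, rfl⟩ := hj
              have := h i
              rw [hg1]
              simp only [G'] at this
              revert this
              cases G (C i) with
              | none => simp
              | some b => cases b <;> cases z (C i) <;> cases v i <;> simp
            · right; rw [hGn j hj, hg2 v j hj]
          · intro h i
            have := h (C i)
            rw [hg1] at this
            simp only [G']
            revert this
            cases G (C i) with
            | none => simp
            | some b => cases b <;> cases z (C i) <;> cases v i <;> simp
        ext w
        constructor
        · rintro ⟨v, hv, rfl⟩; exact (hiff v).1 hv
        · intro hw
          have h1 := hTg w (verts_mono hle hw)
          exact ⟨_, (hiff _).2 (h1.symm ▸ hw), h1⟩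
      exact this ▸ hFS

/-- intersection of faces -/
def meet {n : ℕ} (F G : CubeFace n) : CubeFace n := fun i => if F i = none then G i else F i

theorem verts_meet {n : ℕ} (F G : CubeFace n) (h : (verts F ∩ verts G).Nonempty) :
    verts F ∩ verts G = verts (meet F G) := by
  obtain ⟨x, hx1, hx2⟩ := h
  rw [mem_verts] at hx1 hx2
  ext w
  simp only [Set.mem_inter_iff, mem_verts, ← forall_and]
  apply forall_congr'
  intro i
  have a := hx1 i
  have b := hx2 i
  by_cases hF : F i = none
  · simp [meet, hF]
  · by_cases hG : G i = none
    · simp [meet, hF, hG]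
    · simp only [hF, hG, false_or] at a b
      simp only [meet, hF, hG, false_or, if_false]
      rw [← a, ← b]
      simp

end CubeFace

open CubeFace in
/-- a subcomplex `S ≅ ∂I^{k+1}` of a subcomplex `K ⊆ I^n` (`k ≥ 1`) is
face-like in `K` iff it is not the boundary of a `(k+1)`-dimensional face of `K`. -/
theorem sphere_facelike_iff_not_boundary_of_face
    {n k : ℕ} (hk : 1 ≤ k) (K : Set (CubeFace n)) (hK : IsSubcomplex K)
    (S : Set (CubeFace n)) (hS : IsSubcomplex S) (hSK : S ⊆ K)
    (hiso : Iso S (boundaryCube (k + 1))) :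
    FaceLike K S ↔ ¬ ∃ F ∈ K, dim F = k + 1 ∧ S = bdryHat F := by
  obtain ⟨T, hTd, hST, hcv⟩ := sphere_eq_bdry hk S hS hiso
  constructor
  · rintro hfl ⟨F, hFK, hd, hSF⟩
    have hsub : verts F ⊆ cvert S := by
      intro v hv
      change toFace v ∈ S
      rw [hSF]
      refine ⟨hv, ?_⟩
      intro h
      have h0 : dim F = 0 := by
        rw [← h]; simp [dim, toFace]
      omega
    rcases hfl F hFK with h | ⟨G, hG, h⟩
    · rw [Set.inter_eq_left.2 hsub] at h
      exact (verts_nonempty F).ne_empty h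
    · rw [Set.inter_eq_left.2 hsub] at h
      rw [hSF] at hG
      exact hG.2 (verts_inj h).symm
  · intro hno F hF
    rw [hcv]
    rcases Set.eq_empty_or_nonempty (verts F ∩ verts T) with h | h
    · exact Or.inl h
    · right
      have hm := verts_meet F T h
      refine ⟨meet F T, ?_, hm⟩
      rw [hST]
      refine ⟨le_of_verts (hm ▸ Set.inter_subset_right), ?_⟩
      intro he
      rw [he] at hm
      have hle : T ≤ F := le_of_verts (hm ▸ Set.inter_subset_left)
      exact hno ⟨T, hK.2 F hF T hle, hTd, hST⟩
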